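/- Let T > 0 and let ℓ, κ : (0,T) → ℝ be integrable and nonnegative with (ℓ ∗ κ)(t) = 1 for almost every t ∈ (0,T). Let v, f : (0,T) → ℝ be integrable and suppose that ∫₀^t κ(t − s) v(s) ds = ∫₀^t f(s) ds for every t ∈ [0,T]. Then (ℓ ∗ f)(t) = v(t) for almost every t ∈ (0,T). -/

import Mathlib

open MeasureTheory

noncomputable def cvS8 (a b : ℝ → ℝ) : ℝ → ℝ :=
  MeasureTheory.convolution a b (ContinuousLinearMap.mul ℝ ℝ) volume

lemma cvS8_apply (a b : ℝ → ℝ) (x : ℝ) : cvS8 a b x = ∫ s, a (x - s) * b s :=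
  convolution_mul_swap

lemma cvS8_comm (a b : ℝ → ℝ) : cvS8 a b = cvS8 b a := by
  ext x
  rw [cvS8_apply]
  simp only [cvS8, convolution_mul]
  simp_rw [mul_comm]

lemma cvS8_assoc {a b c : ℝ → ℝ} (ha : Integrable a) (hb : Integrable b) (hc : Integrable c) :
    ∀ᵐ x, cvS8 (cvS8 a b) c x = cvS8 a (cvS8 b c) x := by
  have h := ha.norm.ae_convolution_exists (ContinuousLinearMap.mul ℝ ℝ)
    (hb.norm.integrable_convolution (ContinuousLinearMap.mul ℝ ℝ) hc.norm)
  filter_upwards [h] with x hx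
  exact convolution_assoc _ _ _ _ (fun x y z => by simp [mul_assoc]) ha.1 hb.1 hc.1
    (ha.ae_convolution_exists _ hb) (hb.norm.ae_convolution_exists _ hc.norm) hx

lemma cvS8_int {a b : ℝ → ℝ} (ha : Integrable a) (hb : Integrable b) : Integrable (cvS8 a b) :=
  ha.integrable_convolution _ hb

lemma cvS8_zero {a b : ℝ → ℝ} (ha : ∀ x ≤ 0, a x = 0) (hb : ∀ x ≤ 0, b x = 0) :
    ∀ x ≤ 0, cvS8 a b x = 0 := by
  intro x hx
  rw [cvS8_apply, ← integral_zero ℝ ℝ]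
  congr 1
  ext s
  rcases le_total s 0 with h | h
  · simp [hb s h]
  · simp [ha (x - s) (by linarith)]

lemma cvS8_interval {a b : ℝ → ℝ} (ha : ∀ x ≤ 0, a x = 0) (hb : ∀ x ≤ 0, b x = 0) {t : ℝ}
    (ht : 0 ≤ t) : cvS8 a b t = ∫ s in (0 : ℝ)..t, a (t - s) * b s := by
  rw [cvS8_apply, intervalIntegral.integral_of_le ht, setIntegral_eq_integral_of_forall_compl_eq_zero]
  intro s hs
  rcases le_or_gt s 0 with h | h
  · simp [hb s h]
  · rw [ha (t - s) (by by_contra h'; exact hs ⟨h, by linarith⟩), zero_mul]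

lemma cvS8_congr {a b c : ℝ → ℝ} {T : ℝ} (ha : ∀ x ≤ 0, a x = 0) (hb : ∀ x ≤ 0, b x = 0)
    (hc : ∀ x ≤ 0, c x = 0) (hab : ∀ᵐ x, x ∈ Set.Ioo 0 T → a x = b x) {t : ℝ} (ht : t < T) :
    cvS8 c a t = cvS8 c b t := by
  rw [cvS8_apply, cvS8_apply]
  apply integral_congr_ae
  filter_upwards [hab] with s hs
  rcases le_or_gt s 0 with h | h
  · simp [ha s h, hb s h]
  rcases le_or_gt (t - s) 0 with h' | h'
  · simp [hc _ h']
  · rw [hs ⟨h, by linarith⟩]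

lemma cvS8_ind (a b : ℝ → ℝ) {T t : ℝ} (ht : t ∈ Set.Ioo 0 T) :
    cvS8 ((Set.Ioo 0 T).indicator a) ((Set.Ioo 0 T).indicator b) t
      = ∫ s in (0 : ℝ)..t, a (t - s) * b s := by
  have hz : ∀ a : ℝ → ℝ, ∀ x ≤ 0, (Set.Ioo 0 T).indicator a x = 0 := fun a x hx =>
    Set.indicator_of_notMem (fun h => absurd h.1 (not_lt.mpr hx)) _
  rw [cvS8_interval (hz a) (hz b) ht.1.le, intervalIntegral.integral_of_le ht.1.le,
    intervalIntegral.integral_of_le ht.1.le, integral_Ioc_eq_integral_Ioo,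
    integral_Ioc_eq_integral_Ioo]
  apply setIntegral_congr_fun measurableSet_Ioo
  intro s hs
  have h1 : s ∈ Set.Ioo 0 T := ⟨hs.1, hs.2.trans ht.2⟩
  have h2 : t - s ∈ Set.Ioo 0 T := ⟨by linarith [hs.2], by linarith [hs.1, ht.2]⟩
  simp only [Set.indicator_of_mem h1, Set.indicator_of_mem h2]

/-- Inversion step: if `ℓ, κ ≥ 0` are integrable with `(ℓ ∗ κ) ≡ 1` a.e. on `(0,T)`
and `κ ∗ v` is absolutely continuous with derivative `f` (i.e. `(κ ∗ v)(t) = ∫₀ᵗ f`),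
then `ℓ ∗ f = v` a.e. on `(0,T)`. -/
theorem stmt_8 (T : ℝ) (hT : 0 < T) (ℓ κ v f : ℝ → ℝ)
    (hℓint : IntegrableOn ℓ (Set.Ioo 0 T))
    (hκint : IntegrableOn κ (Set.Ioo 0 T))
    (hℓpos : ∀ t ∈ Set.Ioo (0 : ℝ) T, 0 ≤ ℓ t)
    (hκpos : ∀ t ∈ Set.Ioo (0 : ℝ) T, 0 ≤ κ t)
    (hℓκ : ∀ᵐ t ∂(volume.restrict (Set.Ioo (0 : ℝ) T)),
      (∫ s in (0 : ℝ)..t, ℓ (t - s) * κ s) = 1)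
    (hvint : IntegrableOn v (Set.Ioo 0 T))
    (hfint : IntegrableOn f (Set.Ioo 0 T))
    (hconv : ∀ t ∈ Set.Icc (0 : ℝ) T,
      (∫ s in (0 : ℝ)..t, κ (t - s) * v s) = ∫ s in (0 : ℝ)..t, f s) :
    (fun t => ∫ s in (0 : ℝ)..t, ℓ (t - s) * f s)
      =ᵐ[volume.restrict (Set.Ioo (0 : ℝ) T)] v := by
  have hz : ∀ a : ℝ → ℝ, ∀ x ≤ 0, (Set.Ioo 0 T).indicator a x = 0 := fun a x hx =>
    Set.indicator_of_notMem (fun h => absurd h.1 (not_lt.mpr hx)) _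
  set L := (Set.Ioo 0 T).indicator ℓ with hL
  set K := (Set.Ioo 0 T).indicator κ with hK
  set V := (Set.Ioo 0 T).indicator v with hV
  set F := (Set.Ioo 0 T).indicator f with hF
  set U := (Set.Ioo 0 T).indicator (fun _ => (1 : ℝ)) with hU
  have iL : Integrable L := hℓint.integrable_indicator measurableSet_Ioo
  have iK : Integrable K := hκint.integrable_indicator measurableSet_Ioo
  have iV : Integrable V := hvint.integrable_indicator measurableSet_Ioo
  have iF : Integrable F := hfint.integrable_indicator measurableSet_Ioo
  have iU : Integrable U :=
    (integrableOn_const (by simp)).integrable_indicator measurableSet_Ioo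
  have zL : ∀ x ≤ 0, L x = 0 := hz ℓ
  have zK : ∀ x ≤ 0, K x = 0 := hz κ
  have zV : ∀ x ≤ 0, V x = 0 := hz v
  have zF : ∀ x ≤ 0, F x = 0 := hz f
  have zU : ∀ x ≤ 0, U x = 0 := hz _
  have e1 : ∀ᵐ x, x ∈ Set.Ioo 0 T → U x = cvS8 L K x := by
    rw [ae_restrict_iff' measurableSet_Ioo] at hℓκ
    filter_upwards [hℓκ] with x hx hxT
    rw [hL, hK, cvS8_ind _ _ hxT, hx hxT, hU, Set.indicator_of_mem hxT]
  have e2 : ∀ᵐ x, x ∈ Set.Ioo 0 T → cvS8 K V x = cvS8 U F x := by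
    refine Filter.Eventually.of_forall fun x hxT => ?_
    rw [hK, hV, cvS8_ind _ _ hxT, hU, hF, cvS8_ind _ _ hxT, hconv x ⟨hxT.1.le, hxT.2.le⟩]
    simp
  set G := cvS8 L F with hG
  have iG : Integrable G := cvS8_int iL iF
  have zG : ∀ x ≤ 0, G x = 0 := cvS8_zero zL zF
  have prim : ∀ H : ℝ → ℝ, (∀ x ≤ 0, H x = 0) → ∀ t ∈ Set.Ioo 0 T,
      cvS8 U H t = ∫ s in (0 : ℝ)..t, H s := by
    intro H zH t ht
    rw [cvS8_interval zU zH ht.1.le, intervalIntegral.integral_of_le ht.1.le,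
      intervalIntegral.integral_of_le ht.1.le, integral_Ioc_eq_integral_Ioo,
      integral_Ioc_eq_integral_Ioo]
    apply setIntegral_congr_fun measurableSet_Ioo
    intro s hs
    have h2 : t - s ∈ Set.Ioo 0 T := ⟨by linarith [hs.2], by linarith [hs.1, ht.2]⟩
    simp only [hU, Set.indicator_of_mem h2, one_mul]
  have key : (fun t => ∫ s in (0 : ℝ)..t, G s)
      =ᵐ[volume.restrict (Set.Ioo (0 : ℝ) T)] (fun t => ∫ s in (0 : ℝ)..t, V s) := by
    rw [Filter.EventuallyEq, ae_restrict_iff' measurableSet_Ioo]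
    filter_upwards [cvS8_assoc iL iK iV, cvS8_assoc iL iU iF, cvS8_assoc iU iL iF]
      with t h1 h2 h3 ht
    rw [← prim G zG t ht, ← prim V zV t ht, hG, ← h3, cvS8_comm U L, h2,
      ← cvS8_congr (cvS8_zero zK zV) (cvS8_zero zU zF) zL e2 ht.2, ← h1,
      cvS8_comm _ V, cvS8_comm U V]
    exact (cvS8_congr zU (cvS8_zero zL zK) zV e1 ht.2).symm
  have key2 := Measure.eqOn_open_of_ae_eq key isOpen_Ioo
    (iG.continuous_primitive 0).continuousOn (iV.continuous_primitive 0).continuousOn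
  rw [Filter.EventuallyEq, ae_restrict_iff' measurableSet_Ioo]
  filter_upwards [LocallyIntegrable.ae_hasDerivAt_integral iG.locallyIntegrable,
    LocallyIntegrable.ae_hasDerivAt_integral iV.locallyIntegrable] with t h1 h2 ht
  have h3 := (h1 0).congr_of_eventuallyEq
    (Filter.eventuallyEq_of_mem (isOpen_Ioo.mem_nhds ht) key2.symm)
  have h4 : G t = V t := h3.unique (h2 0)
  rw [hG, hL, hF, cvS8_ind _ _ ht, hV, Set.indicator_of_mem ht] at h4
  exact h4
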